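/- arXiv:2207.00051 — 3 statements merged into one kernel-verified Lean document; each statement's English description precedes it below -/
import Mathlib

section
/- For positive integers F and a, there exists a reflective numerical semigroup S with Frobenius number F(S) = F and multiplicity m(S) = a if and only if all three of the following hold: (1) 2 ≤ a ≤ F + 1; (2) a ∤ F; and (3) ⌊F/a⌋ is even. -/
/-- A numerical semigroup: a subset of ℕ containing 0, closed under addition,
with finite complement. -/
def IsNumericalSemigroup (S : Set ℕ) : Prop :=
  0 ∈ S ∧ (∀ a ∈ S, ∀ b ∈ S, a + b ∈ S) ∧ Sᶜ.Finite

/-- The genus: number of gaps. -/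
noncomputable def genus (S : Set ℕ) : ℕ := Sᶜ.ncard

/-- The Frobenius number: the largest gap. -/
noncomputable def frob (S : Set ℕ) : ℕ := sSup Sᶜ

/-- The multiplicity: the smallest positive element. -/
noncomputable def mult (S : Set ℕ) : ℕ := sInf {n ∈ S | 0 < n}

/-- A numerical semigroup is reflective if for each z ∈ {0,...,g-1}
exactly one of z and z + g lies in S, where g is the genus. -/
def Reflective (S : Set ℕ) : Prop :=
  ∀ z < genus S, Xor' (z ∈ S) (z + genus S ∈ S)

/-- A set A is equidistributed modulo m if each residue class mod m contains
the same number of elements of A. -/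
def Equidistributed (A : Set ℕ) (m : ℕ) : Prop :=
  ∀ r₁ < m, ∀ r₂ < m, {x ∈ A | x % m = r₁}.ncard = {x ∈ A | x % m = r₂}.ncard

/-- The submonoid of ℕ generated by A. -/
def gen (A : Set ℕ) : Set ℕ := (AddSubmonoid.closure A : Set ℕ)

/-- The (unique) minimal generating set of a numerical semigroup: nonzero elements
not expressible as a sum of two nonzero elements. -/
def minGens (S : Set ℕ) : Set ℕ :=
  {n ∈ S | n ≠ 0 ∧ ∀ a ∈ S, ∀ b ∈ S, a ≠ 0 → b ≠ 0 → n ≠ a + b}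

/-- The embedding dimension: the cardinality of the minimal generating set. -/
noncomputable def embdim (S : Set ℕ) : ℕ := (minGens S).ncard

/-- The Apéry set of S relative to t: elements s of S with s - t ∉ S. -/
def aperySet (S : Set ℕ) (t : ℕ) : Set ℕ := {s ∈ S | ∀ u ∈ S, s ≠ u + t}

/-- Pseudo-Frobenius numbers: gaps h such that h + s ∈ S for every nonzero s ∈ S. -/
def pseudoFrobenius (S : Set ℕ) : Set ℕ :=
  {h | h ∉ S ∧ ∀ s ∈ S, s ≠ 0 → h + s ∈ S}

/-- Membership of an integer in (the image in ℤ of) a numerical semigroup. -/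
def memZ (S : Set ℕ) (z : ℤ) : Prop := 0 ≤ z ∧ z.toNat ∈ S

/-- Symmetric numerical semigroup. -/
def IsSymmetricNS (S : Set ℕ) : Prop :=
  ∀ z : ℤ, Xor' (memZ S z) (memZ S ((frob S : ℤ) - z))

/-- Pseudo-symmetric numerical semigroup. -/
def IsPseudoSymmetricNS (S : Set ℕ) : Prop :=
  2 ∣ frob S ∧ ∀ z : ℤ, z ≠ (frob S : ℤ) / 2 →
    Xor' (memZ S z) (memZ S ((frob S : ℤ) - z))

/-- Irreducible numerical semigroup. -/
def IsIrreducibleNS (S : Set ℕ) : Prop :=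
  ¬ ∃ T₁ T₂ : Set ℕ, IsNumericalSemigroup T₁ ∧ IsNumericalSemigroup T₂ ∧
    S ⊂ T₁ ∧ S ⊂ T₂ ∧ S = T₁ ∩ T₂

/-- A telescopic sequence a₁,...,a_k (1-indexed) of positive integers. -/
def TelescopicSeq (a : ℕ → ℕ) (k : ℕ) : Prop :=
  (∀ i ∈ Finset.Icc 1 k, 0 < a i) ∧
  ∀ j ∈ Finset.Icc 2 k,
    ((Finset.Icc 1 (j-1)).gcd a / (Finset.Icc 1 j).gcd a) * a j ∈
      gen (a '' Set.Icc 1 (j-1))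

/-- A free numerical semigroup: one generated by (the underlying set of)
a telescopic sequence. -/
def IsFreeNS (S : Set ℕ) : Prop :=
  ∃ (k : ℕ) (a : ℕ → ℕ), TelescopicSeq a k ∧ S = gen (a '' Set.Icc 1 k)

/-- The element of `{z, z + g}` that is a gap of `S` when exactly one of the two lies in `S`. -/
noncomputable def reflectGap (S : Set ℕ) (g z : ℕ) : ℕ :=
  open Classical in if z ∈ S then z + g else z

theorem reflectGap_mod {S : Set ℕ} {g z : ℕ} (hz : z < g) : reflectGap S g z % g = z := by
  unfold reflectGap
  split_ifs
  · rw [Nat.add_mod_right, Nat.mod_eq_of_lt hz]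
  · exact Nat.mod_eq_of_lt hz

theorem card_image_reflectGap (S : Set ℕ) (g : ℕ) :
    ((Finset.range g).image (reflectGap S g)).card = g := by
  rw [Finset.card_image_of_injOn, Finset.card_range]
  intro x hx y hy hxy
  rw [← reflectGap_mod (S := S) (Finset.mem_range.1 hx),
    ← reflectGap_mod (S := S) (Finset.mem_range.1 hy)]
  exact congrArg (· % g) hxy

theorem image_reflectGap_subset {S : Set ℕ} {g : ℕ}
    (h : ∀ z < g, Xor (z ∈ S) (z + g ∈ S)) :
    (((Finset.range g).image (reflectGap S g) : Finset ℕ) : Set ℕ) ⊆ Sᶜ := by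
  intro n hn
  obtain ⟨z, hz, rfl⟩ := Finset.mem_image.1 (Finset.mem_coe.1 hn)
  have := h z (Finset.mem_range.1 hz)
  unfold reflectGap
  split_ifs with hS
  · rcases this with h | h
    · exact h.2
    · exact absurd hS h.2
  · exact hS

theorem Reflective.exists_of_notMem {S : Set ℕ} (hfin : Sᶜ.Finite) (h : Reflective S)
    {n : ℕ} (hn : n ∉ S) :
    ∃ z < genus S, (z ∈ S ∧ n = z + genus S) ∨ n = z := by
  have heq := Set.eq_of_subset_of_ncard_le (image_reflectGap_subset h)
    (by rw [Set.ncard_coe_finset, card_image_reflectGap]; exact le_rfl) hfin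
  have hn' : n ∈ Sᶜ := hn
  rw [← heq] at hn'
  obtain ⟨z, hz, rfl⟩ := Finset.mem_image.1 (Finset.mem_coe.1 hn')
  refine ⟨z, Finset.mem_range.1 hz, ?_⟩
  unfold reflectGap
  split_ifs with hS
  · exact Or.inl ⟨hS, rfl⟩
  · exact Or.inr rfl

theorem genus_eq_of_xor {S : Set ℕ} {g : ℕ} (h : ∀ z < g, Xor (z ∈ S) (z + g ∈ S))
    (hlt : ∀ n ∉ S, n < 2 * g) : genus S = g := by
  have heq : (((Finset.range g).image (reflectGap S g) : Finset ℕ) : Set ℕ) = Sᶜ := by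
    refine (image_reflectGap_subset h).antisymm fun n hn => ?_
    have hn2 := hlt n hn
    refine Finset.mem_coe.2 (Finset.mem_image.2 ?_)
    by_cases hg : n < g
    · exact ⟨n, Finset.mem_range.2 hg, if_neg hn⟩
    · refine ⟨n - g, Finset.mem_range.2 (by omega), ?_⟩
      have hx := h (n - g) (by omega)
      rw [Nat.sub_add_cancel (by omega)] at hx
      have hm : n - g ∈ S := by
        rcases hx with hx | hx
        · exact hx.1
        · exact absurd hx.1 hn
      exact (if_pos hm).trans (Nat.sub_add_cancel (by omega))
  rw [genus, ← heq, Set.ncard_coe_finset, card_image_reflectGap]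

theorem IsNumericalSemigroup.add_mul_mem {S : Set ℕ} (hS : IsNumericalSemigroup S) {n a : ℕ}
    (hn : n ∈ S) (ha : a ∈ S) (k : ℕ) : n + a * k ∈ S := by
  induction k with
  | zero => simpa using hn
  | succ k ih => rw [Nat.mul_succ, ← add_assoc]; exact hS.2.1 _ ih _ ha

theorem isGreatest_frob {S : Set ℕ} (hfin : Sᶜ.Finite) (hF : 0 < frob S) :
    IsGreatest Sᶜ (frob S) := by
  have hne : Sᶜ.Nonempty := by
    by_contra! h
    simp [frob, h] at hF
  exact ⟨Nat.sSup_mem hne hfin.bddAbove, fun _ hn => le_csSup hfin.bddAbove hn⟩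

theorem isLeast_mult {S : Set ℕ} (hm : 0 < mult S) : IsLeast {n ∈ S | 0 < n} (mult S) := by
  have hne : {n ∈ S | 0 < n}.Nonempty := by
    by_contra! h
    simp [mult, h] at hm
  exact ⟨Nat.sInf_mem hne, fun _ hn => Nat.sInf_le hn⟩

theorem Reflective.frob_mult {S : Set ℕ} (hS : IsNumericalSemigroup S) (h : Reflective S)
    (hF : 0 < frob S) (ha : 0 < mult S) :
    2 ≤ mult S ∧ mult S ≤ frob S + 1 ∧ ¬ mult S ∣ frob S ∧ (frob S / mult S) % 2 = 0 := by
  obtain ⟨hFS, hFmax⟩ := isGreatest_frob hS.2.2 hF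
  obtain ⟨⟨haS, -⟩, hamin⟩ := isLeast_mult ha
  have hgap := fun {n} (hn : n ∉ S) => h.exists_of_notMem hS.2.2 hn
  have hx : ∀ z < genus S, Xor (z ∈ S) (z + genus S ∈ S) := h
  generalize frob S = F at *
  generalize mult S = a at *
  generalize genus S = g at *
  have hFS' : F ∉ S := hFS
  have hmax : ∀ n, n ∉ S → n ≤ F := fun n hn => hFmax hn
  have hmin : ∀ n ∈ S, 0 < n → a ≤ n := fun n hn h0 => hamin ⟨hn, h0⟩
  have h0 := hS.1
  have hmul : ∀ k, a * k ∈ S := fun k => by simpa using hS.add_mul_mem h0 haS k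
  have hdvd : ¬ a ∣ F := by
    rintro ⟨k, rfl⟩
    exact hFS' (hmul k)
  have ha2 : 2 ≤ a := by
    by_contra hlt
    obtain rfl : a = 1 := by omega
    exact hdvd (one_dvd F)
  have haF : a ≤ F + 1 := by
    by_contra hlt
    have hn : F + 1 ∉ S := fun hn => hlt (hmin _ hn (by omega))
    have := hmax _ hn
    omega
  refine ⟨ha2, haF, hdvd, ?_⟩
  have hg0 : 0 < g := by
    obtain ⟨z, hz, -⟩ := hgap hFS'
    omega
  have hup : ∀ z < g, z ∈ S → z + g ∉ S := fun z hz hzS => by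
    rcases hx z hz with h | h
    · exact h.2
    · exact absurd hzS h.2
  have hup' : ∀ z < g, z ∉ S → z + g ∈ S := fun z hz hzS => by
    rcases hx z hz with h | h
    · exact absurd h.1 hzS
    · exact h.1
  have hgS : g ∉ S := by simpa using hup 0 hg0 h0
  have hgF : g ≤ F := hmax g hgS
  obtain ⟨z, hz, ⟨hzS, hFz⟩ | rfl⟩ := hgap hFS'
  swap
  · omega
  by_cases hag : g < a
  · have hz0 : z = 0 := by
      by_contra hne
      have := hmin z hzS (by omega)
      omega
    rw [Nat.div_eq_of_lt (by omega)]
  have hne : a ≠ g := fun he => hgS (he ▸ haS)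
  have hres : ∀ n, g < n → n % a ≠ g % a → n ∈ S := by
    intro n hn hmod
    have hi : (n - g) % a ≠ 0 := by
      intro h0
      apply hmod
      have : n = g + (n - g) := by omega
      rw [this, Nat.add_mod, h0, add_zero, Nat.mod_mod]
    have hlt : (n - g) % a < a := Nat.mod_lt _ ha
    have hiS : (n - g) % a ∉ S := fun hi' => by
      have := hmin _ hi' (by omega)
      omega
    have hk := hS.add_mul_mem (hup' _ (by omega) hiS) haS ((n - g) / a)
    have := Nat.mod_add_div (n - g) a
    have he : (n - g) % a + g + a * ((n - g) / a) = n := by omega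
    rwa [he] at hk
  have hza : a ∣ z := by
    by_cases hz0 : z = 0
    · simp [hz0]
    have hmod : F % a = g % a := by
      by_contra hmod
      exact hFS' (hres F (by omega) hmod)
    have := (Nat.modEq_iff_dvd' hgF).1 (Eq.symm hmod)
    rwa [hFz, Nat.add_sub_cancel] at this
  obtain ⟨k, rfl⟩ := hza
  have hdm := Nat.div_add_mod g a
  have hr0 : g % a ≠ 0 := by
    intro h0
    rw [h0, add_zero] at hdm
    exact hgS (hdm ▸ hmul _)
  have hr : g % a < a := Nat.mod_lt _ ha
  have hle := hmax _ (hup (a * (g / a)) (by omega) (hmul _))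
  have hle' : a * (g / a) ≤ a * k := by omega
  have h1 : g / a ≤ k := Nat.le_of_mul_le_mul_left hle' ha
  have h2 : k ≤ g / a := (Nat.le_div_iff_mul_le ha).2 (by rw [mul_comm]; omega)
  obtain rfl : k = g / a := le_antisymm h2 h1
  have hFe : F = g % a + a * (2 * (g / a)) := by
    rw [mul_left_comm]
    omega
  rw [hFe, Nat.add_mul_div_left _ _ ha, Nat.div_eq_of_lt hr]
  omega

theorem exists_reflective_of_decomp {a q r : ℕ} (hr0 : 0 < r) (hra : r < a)
    (hq : q = 0 → a = r + 1) :
    ∃ S : Set ℕ, IsNumericalSemigroup S ∧ Reflective S ∧ frob S = r + a * (2 * q) ∧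
      mult S = a := by
  obtain ⟨g, hg⟩ : ∃ g, g = r + a * q := ⟨_, rfl⟩
  obtain ⟨F, hF⟩ : ∃ F, F = r + a * (2 * q) := ⟨_, rfl⟩
  have hFg : F = g + a * q := by rw [hF, hg]; ring
  have haq : q ≠ 0 → a ≤ a * q := fun h => Nat.le_mul_of_pos_right a (by omega)
  have hgdvd : ¬ a ∣ g := by
    rw [hg, Nat.dvd_add_left (dvd_mul_right a q)]
    exact Nat.not_dvd_of_pos_of_lt hr0 hra
  have hgmod : g % a = r := by rw [hg, Nat.add_mul_mod_self_left, Nat.mod_eq_of_lt hra]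
  have hFmod : F % a = r := by rw [hF, Nat.add_mul_mod_self_left, Nat.mod_eq_of_lt hra]
  let S : Set ℕ := {n | a ∣ n ∨ (g < n ∧ n % a ≠ r) ∨ F < n}
  have hmem : ∀ n, n ∈ S ↔ a ∣ n ∨ (g < n ∧ n % a ≠ r) ∨ F < n := fun _ => Iff.rfl
  have hgap : ∀ n ∉ S, n ≤ F := fun n hn => by
    rw [hmem] at hn
    omega
  have hx : ∀ z < g, Xor (z ∈ S) (z + g ∈ S) := by
    intro z hz
    by_cases hza : a ∣ z
    · refine Or.inl ⟨Or.inl hza, ?_⟩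
      obtain ⟨k, rfl⟩ := hza
      have hk : k < q + 1 := by
        refine Nat.lt_of_mul_lt_mul_left (a := a) ?_
        rw [mul_add]
        omega
      have hk' : a * k ≤ a * q := Nat.mul_le_mul_left a (by omega)
      rintro (h | h | h)
      · exact hgdvd ((Nat.dvd_add_right (dvd_mul_right a k)).1 h)
      · exact h.2 (by rw [Nat.mul_add_mod, hgmod])
      · omega
    · refine Or.inr ⟨Or.inr (Or.inl ⟨?_, ?_⟩), ?_⟩
      · have : z ≠ 0 := fun h => hza (h ▸ dvd_zero a)
        omega
      · intro h
        have := (Nat.modEq_iff_dvd' (Nat.le_add_left g z)).1 (hgmod.trans h.symm)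
        rw [Nat.add_sub_cancel] at this
        exact hza this
      · rintro (h | h | h)
        · exact hza h
        · omega
        · omega
  have hgenus : genus S = g := genus_eq_of_xor hx fun n hn => by
    have := hgap n hn
    omega
  have hFS : F ∉ S := by
    rintro (h | h | h)
    · rw [Nat.dvd_iff_mod_eq_zero] at h
      omega
    · exact h.2 hFmod
    · omega
  refine ⟨S, ⟨Or.inl (dvd_zero a), ?_, ?_⟩, ?_, ?_, ?_⟩
  · have hadd : ∀ x y, a ∣ x → y ∈ S → x + y ∈ S := by
      rintro x y hx (hy | hy | hy)
      · exact Or.inl (dvd_add hx hy)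
      · obtain ⟨k, rfl⟩ := hx
        exact Or.inr (Or.inl ⟨by omega, by rw [Nat.mul_add_mod]; exact hy.2⟩)
      · exact Or.inr (Or.inr (by omega))
    intro x hx y hy
    by_cases hxa : a ∣ x
    · exact hadd x y hxa hy
    by_cases hya : a ∣ y
    · rw [add_comm]
      exact hadd y x hya hx
    refine Or.inr (Or.inr ?_)
    rw [hmem] at hx hy
    have hx' : g < x := by
      rcases hx with h | h | h
      · exact absurd h hxa
      · exact h.1
      · omega
    have hy' : g < y := by
      rcases hy with h | h | h
      · exact absurd h hya
      · exact h.1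
      · omega
    omega
  · exact (Set.finite_Iic F).subset hgap
  · intro z hz
    rw [hgenus] at hz ⊢
    exact hx z hz
  · rw [← hF]
    exact IsGreatest.csSup_eq ⟨hFS, hgap⟩
  · refine IsLeast.csInf_eq ⟨⟨Or.inl dvd_rfl, by omega⟩, ?_⟩
    rintro n ⟨hn | hn, hpos⟩
    · exact Nat.le_of_dvd hpos hn
    · by_cases hq0 : q = 0
      · have := hq hq0
        omega
      · have := haq hq0
        omega

theorem stmt17 (F a : ℕ) (hF : 0 < F) (ha : 0 < a) :
    (∃ S : Set ℕ, IsNumericalSemigroup S ∧ Reflective S ∧ frob S = F ∧ mult S = a) ↔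
      (2 ≤ a ∧ a ≤ F + 1 ∧ ¬ a ∣ F ∧ (F / a) % 2 = 0) := by
  constructor
  · rintro ⟨S, hS, h, rfl, rfl⟩
    exact h.frob_mult hS hF ha
  · rintro ⟨-, haF, hdvd, heven⟩
    have hdm := Nat.mod_add_div F a
    have hlt := Nat.mod_lt F ha
    rw [Nat.dvd_iff_mod_eq_zero] at hdvd
    obtain ⟨q, hq⟩ := Nat.dvd_of_mod_eq_zero heven
    rw [hq] at hdm
    obtain ⟨S, hS⟩ := exists_reflective_of_decomp (q := q) (Nat.pos_of_ne_zero hdvd) hlt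
      (by rintro rfl; omega)
    rw [hdm] at hS
    exact ⟨S, hS⟩
end

section
/- For every positive integer F, the number of reflective numerical semigroups S with Frobenius number F(S) = F equals 1 − τₑ(F) + Σ_{k=2}^{F} (−1)^k ⌊F/k⌋, where τₑ(F) denotes the number of even positive divisors of F. -/
/-- The numbers below `2 * g` are in this set when they are multiples of `m` below `g`, or are
`g` plus a non-multiple of `m`; every number from `2 * g` on is in the set. -/
def reflectiveModel (m g : ℕ) : Set ℕ :=
  {n | (n < g ∧ m ∣ n) ∨ (g ≤ n ∧ n < 2 * g ∧ ¬ m ∣ n - g) ∨ 2 * g ≤ n}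

theorem mem_reflectiveModel {m g n : ℕ} : n ∈ reflectiveModel m g ↔
    (n < g ∧ m ∣ n) ∨ (g ≤ n ∧ n < 2 * g ∧ ¬ m ∣ n - g) ∨ 2 * g ≤ n := Iff.rfl

open Classical in
/-- Choosing one element from each pair `z, z + g` with `z < g` gives `g` elements. -/
theorem card_image_shift (S : Set ℕ) (g : ℕ) :
    ((Finset.range g).image (fun z => if z ∈ S then z + g else z)).card = g := by
  rw [Finset.card_image_of_injOn, Finset.card_range]
  intro a ha b hb hab
  simp only [Finset.coe_range, Set.mem_Iio] at ha hb
  simp only at hab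
  split_ifs at hab <;> omega

open Classical in
theorem Reflective.compl_eq {S : Set ℕ} (hfin : Sᶜ.Finite) (hS : Reflective S) :
    Sᶜ = ((Finset.range (genus S)).image
      (fun z => if z ∈ S then z + genus S else z) : Finset ℕ) := by
  symm
  apply Set.eq_of_subset_of_ncard_le _ _ hfin
  · intro n hn
    simp only [Finset.coe_image, Finset.coe_range, Set.mem_image, Set.mem_Iio] at hn
    obtain ⟨z, hz, rfl⟩ := hn
    have := hS z hz
    split_ifs with h
    · exact fun h' => by rcases this with h1 | h1 <;> tauto
    · exact h
  · rw [Set.ncard_coe_finset, card_image_shift]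
    rfl

theorem Reflective.mem_of_two_mul_genus_le {S : Set ℕ} (hfin : Sᶜ.Finite) (hS : Reflective S)
    {n : ℕ} (hn : 2 * genus S ≤ n) : n ∈ S := by
  classical
  by_contra h
  have h' : n ∈ Sᶜ := h
  rw [hS.compl_eq hfin] at h'
  simp only [Finset.coe_image, Finset.coe_range, Set.mem_image, Set.mem_Iio] at h'
  obtain ⟨z, hz, rfl⟩ := h'
  split_ifs at hn <;> omega

theorem Reflective.exists_eq_reflectiveModel {S : Set ℕ} (hS : IsNumericalSemigroup S)
    (hr : Reflective S) (hg : 0 < genus S) :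
    ∃ m, 0 < m ∧ m ≤ genus S + 1 ∧ ¬ m ∣ genus S ∧ S = reflectiveModel m (genus S) := by
  classical
  obtain ⟨h0, hadd, hfin⟩ := hS
  have hbig : ∀ n, 2 * genus S ≤ n → n ∈ S := fun n hn => hr.mem_of_two_mul_genus_le hfin hn
  generalize hgS : genus S = g at *
  have hr' : ∀ z < g, (z ∈ S ↔ z + g ∉ S) := by
    intro z hz
    have := hr z (hgS ▸ hz)
    rw [hgS] at this
    rcases this with h | h <;> tauto
  have hex : ∃ n, 0 < n ∧ n ∈ S := ⟨2 * g, by omega, hbig _ le_rfl⟩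
  obtain ⟨m, ⟨hm0, hmS⟩, hmin⟩ : ∃ m, (0 < m ∧ m ∈ S) ∧ ∀ n, 0 < n → n ∈ S → m ≤ n :=
    ⟨Nat.find hex, Nat.find_spec hex, fun n h1 h2 => Nat.find_min' hex ⟨h1, h2⟩⟩
  have hgn : g ∉ S := by simpa using (hr' 0 hg).1 h0
  have hmul : ∀ k, m * k ∈ S := by
    intro k
    induction k with
    | zero => simpa using h0
    | succ k ih => exact hadd _ ih _ hmS
  have hmg : ¬ m ∣ g := by
    rintro ⟨k, rfl⟩
    exact hgn (hmul k)
  have hlow : ∀ n < g, (n ∈ S ↔ m ∣ n) := by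
    intro n
    induction n using Nat.strong_induction_on with
    | _ n ih =>
      intro hn
      refine ⟨fun h => ?_, fun ⟨k, hk⟩ => hk ▸ hmul k⟩
      rcases Nat.eq_zero_or_pos n with rfl | hpos
      · simp
      have hmn := hmin n hpos h
      have key : n - m ∈ S := by
        by_contra hc
        have h1 : n - m + g ∈ S := by
          by_contra h2
          exact hc ((hr' (n - m) (by omega)).2 h2)
        have h3 := hadd _ h1 _ hmS
        rw [show n - m + g + m = n + g by omega] at h3
        exact (hr' n hn).1 h h3
      have := (ih (n - m) (by omega) (by omega)).1 key
      exact Nat.sub_add_cancel hmn ▸ dvd_add this dvd_rfl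
  refine ⟨m, hm0, ?_, hmg, ?_⟩
  · by_contra hlt
    rcases Nat.lt_or_ge 1 g with h1 | h1
    · have h2 : 1 ∉ S := fun h => by have := hmin 1 one_pos h; omega
      have h3 : 1 + g ∈ S := by
        by_contra h4
        exact h2 ((hr' 1 h1).2 h4)
      have := hmin _ (by omega) h3
      omega
    · have := hmin 2 (by omega) (hbig 2 (by omega))
      omega
  · ext n
    rw [mem_reflectiveModel]
    rcases Nat.lt_or_ge n g with h1 | h1
    · rw [hlow n h1]
      constructor
      · exact fun h => Or.inl ⟨h1, h⟩
      · rintro (h | h | h)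
        · exact h.2
        · omega
        · omega
    rcases Nat.lt_or_ge n (2 * g) with h2 | h2
    · have h3 := hr' (n - g) (by omega)
      rw [hlow _ (by omega), show n - g + g = n by omega] at h3
      constructor
      · exact fun h => Or.inr (Or.inl ⟨h1, h2, fun hd => h3.1 hd h⟩)
      · rintro (h | h | h)
        · omega
        · by_contra hc
          exact h.2.2 (h3.2 hc)
        · omega
    · exact ⟨fun _ => Or.inr (Or.inr h2), fun _ => hbig n h2⟩

theorem notMem_reflectiveModel {m g n : ℕ} : n ∉ reflectiveModel m g ↔
    (n < g ∧ ¬ m ∣ n) ∨ (g ≤ n ∧ n < 2 * g ∧ m ∣ n - g) := by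
  rw [mem_reflectiveModel]
  rcases Nat.lt_or_ge n g with h1 | h1
  · have h2 : ¬ g ≤ n := by omega
    have h3 : ¬ 2 * g ≤ n := by omega
    tauto
  · have h2 : ¬ n < g := by omega
    have h3 : 2 * g ≤ n ↔ ¬ n < 2 * g := by omega
    tauto

theorem finite_compl_reflectiveModel (m g : ℕ) : (reflectiveModel m g)ᶜ.Finite := by
  apply (Set.finite_lt_nat (2 * g)).subset
  intro n hn
  rcases notMem_reflectiveModel.1 hn with h | h <;> simp only [Set.mem_ofPred_eq] <;> omega

theorem isNumericalSemigroup_reflectiveModel {m g : ℕ} (h : ¬ m ∣ g) :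
    IsNumericalSemigroup (reflectiveModel m g) := by
  have hg : 0 < g := Nat.pos_of_ne_zero (by rintro rfl; simp at h)
  refine ⟨Or.inl ⟨hg, dvd_zero m⟩, ?_, finite_compl_reflectiveModel m g⟩
  have mixed : ∀ a b, a < g → m ∣ a → g ≤ b → ¬ m ∣ b - g → a + b ∈ reflectiveModel m g := by
    intro a b ha hma hb hmb
    by_contra hc
    rcases notMem_reflectiveModel.1 hc with hc | hc
    · omega
    · rw [Nat.add_sub_assoc hb] at hc
      exact hmb ((Nat.dvd_add_right hma).1 hc.2.2)
  have high : ∀ n, 2 * g ≤ n → n ∈ reflectiveModel m g := fun n hn => Or.inr (Or.inr hn)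
  rintro a (⟨ha, hma⟩ | ⟨ha, -, hma⟩ | ha) b (⟨hb, hmb⟩ | ⟨hb, -, hmb⟩ | hb)
  · by_contra hc
    rcases notMem_reflectiveModel.1 hc with hc | hc
    · exact hc.2 (dvd_add hma hmb)
    · apply h
      have := Nat.dvd_sub (dvd_add hma hmb) hc.2.2
      rwa [Nat.sub_sub_self hc.1] at this
  · exact mixed a b ha hma hb hmb
  · exact high _ (by omega)
  · rw [add_comm]
    exact mixed b a hb hmb ha hma
  all_goals exact high _ (by omega)

theorem mem_reflectiveModel_iff_dvd {m g z : ℕ} (hz : z < g) :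
    z ∈ reflectiveModel m g ↔ m ∣ z := by
  have h1 : ¬ g ≤ z := by omega
  have h2 : ¬ 2 * g ≤ z := by omega
  rw [mem_reflectiveModel]
  tauto

theorem add_mem_reflectiveModel_iff {m g z : ℕ} (hz : z < g) :
    z + g ∈ reflectiveModel m g ↔ ¬ m ∣ z := by
  have h1 : ¬ z + g < g := by omega
  have h2 : ¬ 2 * g ≤ z + g := by omega
  have h3 : g ≤ z + g := by omega
  have h4 : z + g < 2 * g := by omega
  rw [mem_reflectiveModel, Nat.add_sub_cancel]
  tauto

theorem genus_reflectiveModel (m g : ℕ) : genus (reflectiveModel m g) = g := by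
  classical
  have : (reflectiveModel m g)ᶜ = ((Finset.range g).image
      (fun z => if z ∈ reflectiveModel m g then z + g else z) : Finset ℕ) := by
    ext n
    simp only [Finset.coe_image, Finset.coe_range, Set.mem_image, Set.mem_Iio, Set.mem_compl_iff]
    constructor
    · intro hn
      rcases notMem_reflectiveModel.1 hn with h | h
      · exact ⟨n, h.1, if_neg hn⟩
      · refine ⟨n - g, by omega, ?_⟩
        rw [if_pos ((mem_reflectiveModel_iff_dvd (by omega)).2 h.2.2)]
        omega
    · rintro ⟨z, hz, rfl⟩
      split_ifs with h
      · rw [add_mem_reflectiveModel_iff hz]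
        exact not_not.2 ((mem_reflectiveModel_iff_dvd hz).1 h)
      · exact h
  rw [genus, this, Set.ncard_coe_finset, card_image_shift]

theorem reflective_reflectiveModel (m g : ℕ) : Reflective (reflectiveModel m g) := by
  intro z hz
  rw [genus_reflectiveModel] at hz ⊢
  rw [mem_reflectiveModel_iff_dvd hz, add_mem_reflectiveModel_iff hz, Xor']
  tauto

theorem frob_reflectiveModel {m g : ℕ} (hm : 0 < m) (h : ¬ m ∣ g) :
    frob (reflectiveModel m g) = g + m * (g / m) := by
  have hlt : m * (g / m) < g :=
    lt_of_le_of_ne (Nat.mul_div_le g m) fun he => h ⟨_, he.symm⟩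
  refine IsGreatest.csSup_eq ⟨notMem_reflectiveModel.2 (Or.inr ⟨by omega, by omega, ?_⟩), ?_⟩
  · rw [Nat.add_sub_cancel_left]
    exact dvd_mul_right _ _
  · intro n hn
    rcases notMem_reflectiveModel.1 hn with hn | ⟨h1, h2, k, hk⟩
    · omega
    · have : k ≤ g / m := by
        rw [Nat.le_div_iff_mul_le hm, mul_comm]
        omega
      have := Nat.mul_le_mul_left m this
      omega

theorem mult_reflectiveModel {m g : ℕ} (hm : 0 < m) (hle : m ≤ g + 1) (h : ¬ m ∣ g) :
    mult (reflectiveModel m g) = m := by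
  have hne : m ≠ g := by rintro rfl; simp at h
  have h1 : m ≠ 1 := by rintro rfl; simp at h
  refine IsLeast.csInf_eq ⟨⟨?_, hm⟩, ?_⟩
  · rcases Nat.lt_or_ge m g with hlt | hge
    · exact Or.inl ⟨hlt, dvd_rfl⟩
    · obtain rfl : m = g + 1 := by omega
      by_contra hc
      rcases notMem_reflectiveModel.1 hc with hc | hc
      · omega
      · rw [Nat.add_sub_cancel_left, Nat.dvd_one] at hc
        omega
  · rintro n ⟨hn, hn0⟩
    by_contra hlt
    refine notMem_reflectiveModel.2 ?_ hn
    rcases Nat.lt_or_ge n g with hng | hng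
    · exact Or.inl ⟨hng, Nat.not_dvd_of_pos_of_lt hn0 (by omega)⟩
    · obtain rfl : n = g := by omega
      exact Or.inr ⟨le_rfl, by omega, by simp⟩

/-- The multiplicities of the reflective numerical semigroups with Frobenius number `F`. -/
def reflectiveMults (F : ℕ) : Finset ℕ :=
  (Finset.Icc 1 (F + 1)).filter fun m => F / m % 2 = 0 ∧ ¬ 2 * m ∣ F

theorem setOf_reflective_eq_image {F : ℕ} (hF : 0 < F) :
    {S : Set ℕ | IsNumericalSemigroup S ∧ Reflective S ∧ frob S = F} =
      (fun m => reflectiveModel m (F - m * (F / m / 2))) '' (reflectiveMults F : Set ℕ) := by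
  ext S
  simp only [Set.mem_ofPred_eq, Set.mem_image, reflectiveMults, Finset.coe_filter, Finset.mem_Icc]
  constructor
  · rintro ⟨hS, hr, hf⟩
    have hg : 0 < genus S := by
      by_contra hc
      have hall : ∀ n, n ∈ S := fun n => hr.mem_of_two_mul_genus_le hS.2.2 (by omega)
      have : S = Set.univ := Set.eq_univ_of_forall hall
      rw [frob, this] at hf
      simp at hf
      omega
    obtain ⟨m, hm, hle, hmg, hSm⟩ := hr.exists_eq_reflectiveModel hS hg
    generalize genus S = g at *
    subst hSm
    rw [frob_reflectiveModel hm hmg] at hf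
    have hdm := Nat.div_add_mod g m
    have hlt := Nat.mod_lt g hm
    have hr0 : g % m ≠ 0 := fun h0 => hmg (Nat.dvd_of_mod_eq_zero h0)
    generalize g / m = q at *
    generalize g % m = r at *
    have hF2 : F = r + m * (2 * q) := by rw [← hf, ← hdm]; ring
    have hdiv : F / m = 2 * q := by
      rw [hF2, Nat.add_mul_div_left _ _ hm, Nat.div_eq_of_lt hlt, zero_add]
    refine ⟨m, ⟨⟨hm, by omega⟩, by omega, fun hd => ?_⟩, ?_⟩
    · have hd' : 2 * m ∣ r := by
        rw [hF2, show m * (2 * q) = 2 * m * q by ring] at hd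
        exact (Nat.dvd_add_left (dvd_mul_right _ _)).1 hd
      have := Nat.le_of_dvd (by omega) hd'
      omega
    · rw [hdiv, Nat.mul_div_cancel_left _ two_pos]
      congr 1
      omega
  · rintro ⟨m, ⟨⟨hm, hle⟩, he, hd⟩, rfl⟩
    obtain ⟨q, r, hq, hr0, hlt, hF2⟩ :
        ∃ q r, F / m / 2 = q ∧ r ≠ 0 ∧ r < m ∧ F = r + 2 * (m * q) := by
      have hF2 : F = F % m + 2 * (m * (F / m / 2)) := by
        conv_lhs => rw [← Nat.div_add_mod F m, show F / m = 2 * (F / m / 2) by omega]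
        ring
      refine ⟨_, F % m, rfl, fun h0 => hd ?_, Nat.mod_lt _ hm, hF2⟩
      rw [h0, zero_add] at hF2
      exact ⟨F / m / 2, hF2.trans (by ring)⟩
    rw [hq]
    have hg : F - m * q = r + m * q := by omega
    rw [hg]
    have hmg : ¬ m ∣ r + m * q := by
      intro h
      exact Nat.not_dvd_of_pos_of_lt (by omega) hlt ((Nat.dvd_add_left (dvd_mul_right m q)).1 h)
    refine ⟨isNumericalSemigroup_reflectiveModel hmg, reflective_reflectiveModel _ _, ?_⟩
    rw [frob_reflectiveModel hm hmg, Nat.add_mul_div_left _ _ hm, Nat.div_eq_of_lt hlt, zero_add]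
    omega

theorem injOn_reflectiveModel (F : ℕ) :
    Set.InjOn (fun m => reflectiveModel m (F - m * (F / m / 2)))
      (reflectiveMults F : Set ℕ) := by
  have key : ∀ m ∈ (reflectiveMults F : Set ℕ),
      mult (reflectiveModel m (F - m * (F / m / 2))) = m := by
    intro m hm
    simp only [reflectiveMults, Finset.coe_filter, Finset.mem_Icc, Set.mem_ofPred_eq] at hm
    obtain ⟨⟨hm, hle⟩, he, hd⟩ := hm
    have hF : F % m + 2 * (m * (F / m / 2)) = F := by
      conv_rhs => rw [← Nat.div_add_mod F m, show F / m = 2 * (F / m / 2) by omega]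
      ring
    refine mult_reflectiveModel hm ?_ ?_
    · rcases Nat.eq_zero_or_pos (F / m / 2) with h0 | h0
      · rw [h0]
        omega
      · have := Nat.mul_le_mul_left m h0
        omega
    · intro h
      rw [show F - m * (F / m / 2) = F % m + m * (F / m / 2) by omega] at h
      have h0 := Nat.eq_zero_of_dvd_of_lt ((Nat.dvd_add_left (dvd_mul_right m _)).1 h)
        (Nat.mod_lt F hm)
      rw [h0, zero_add] at hF
      exact hd ⟨F / m / 2, hF.symm.trans (by ring)⟩
  intro a ha b hb hab
  rw [← key a ha, ← key b hb]
  exact congrArg mult hab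

theorem sum_Icc_neg_one_pow_mul (f : ℕ → ℤ) (N : ℕ) :
    ∑ k ∈ Finset.Icc 1 (2 * N), (-1 : ℤ) ^ k * f k =
      2 * ∑ k ∈ Finset.Icc 1 N, f (2 * k) - ∑ k ∈ Finset.Icc 1 (2 * N), f k := by
  induction N with
  | zero => simp
  | succ N ih =>
    rw [show 2 * (N + 1) = 2 * N + 1 + 1 by ring]
    rw [Finset.sum_Icc_succ_top (by omega), Finset.sum_Icc_succ_top (by omega), ih,
      Finset.sum_Icc_succ_top (by omega), Finset.sum_Icc_succ_top (by omega),
      Finset.sum_Icc_succ_top (by omega), show 2 * (N + 1) = 2 * N + 1 + 1 by ring,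
      show (-1 : ℤ) ^ (2 * N + 1 + 1) = 1 by simp [pow_succ, pow_mul],
      show (-1 : ℤ) ^ (2 * N + 1) = -1 by simp [pow_succ, pow_mul]]
    ring

theorem sum_Icc_eq_of_le {f : ℕ → ℤ} {F N : ℕ} (hN : F ≤ N) (hf : ∀ k, F < k → f k = 0) :
    ∑ k ∈ Finset.Icc 1 N, f k = ∑ k ∈ Finset.Icc 1 F, f k := by
  symm
  apply Finset.sum_subset (Finset.Icc_subset_Icc_right hN)
  intro k hk hk'
  simp only [Finset.mem_Icc] at hk hk'
  exact hf k (by omega)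

theorem sum_Icc_neg_one_pow_mul_div {F : ℕ} (hF : 0 < F) :
    ∑ k ∈ Finset.Icc 2 F, (-1 : ℤ) ^ k * ((F / k : ℕ) : ℤ) =
      ((Finset.Icc 1 F).filter fun m => F / m % 2 = 0).card := by
  have h := sum_Icc_neg_one_pow_mul (fun k => ((F / k : ℕ) : ℤ)) F
  rw [sum_Icc_eq_of_le (F := F) (by omega) (by intro k hk; simp [Nat.div_eq_of_lt hk]),
    ← Finset.insert_Icc_add_one_left_eq_Icc hF, Finset.sum_insert (by simp),
    Finset.insert_Icc_add_one_left_eq_Icc hF,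
    sum_Icc_eq_of_le (f := fun k => ((F / k : ℕ) : ℤ)) (F := F) (N := 2 * F) (by omega)
      (fun k hk => by simp [Nat.div_eq_of_lt hk])] at h
  have h2 : (((Finset.Icc 1 F).filter fun m => F / m % 2 = 0).card : ℤ) =
      ∑ k ∈ Finset.Icc 1 F, (1 + (2 * ((F / (2 * k) : ℕ) : ℤ) - ((F / k : ℕ) : ℤ))) := by
    rw [Finset.card_filter, Nat.cast_sum]
    apply Finset.sum_congr rfl
    intro k _
    rw [mul_comm 2 k, ← Nat.div_div_eq_div_mul]
    split_ifs <;> push_cast <;> omega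
  rw [h2, Finset.sum_add_distrib, Finset.sum_sub_distrib, ← Finset.mul_sum]
  simp only [pow_one, Nat.div_one, Nat.reduceAdd] at h
  simp only [Finset.sum_const, Nat.card_Icc, Nat.add_sub_cancel, nsmul_eq_mul, mul_one]
  linarith

theorem card_even_divisors {F : ℕ} (hF : 0 < F) :
    ((Nat.divisors F).filter (fun d => 2 ∣ d)).card =
      ((Finset.Icc 1 (F + 1)).filter fun m => 2 * m ∣ F).card := by
  symm
  refine Finset.card_bij (fun m _ => 2 * m) ?_ (fun a _ b _ h => by omega) ?_
  · intro m hm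
    simp only [Finset.mem_filter, Nat.mem_divisors] at hm ⊢
    exact ⟨⟨hm.2, by omega⟩, dvd_mul_right _ _⟩
  · intro d hd
    simp only [Finset.mem_filter, Nat.mem_divisors] at hd
    obtain ⟨⟨hd, -⟩, k, rfl⟩ := hd
    have h1 := Nat.pos_of_dvd_of_pos hd hF
    have h2 := Nat.le_of_dvd hF hd
    exact ⟨k, by simp only [Finset.mem_filter, Finset.mem_Icc]; exact ⟨by omega, hd⟩, rfl⟩

theorem card_reflectiveMults {F : ℕ} (hF : 0 < F) :
    ((reflectiveMults F).card : ℤ) = 1 - ((Nat.divisors F).filter (fun d => 2 ∣ d)).card +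
      ((Finset.Icc 1 F).filter fun m => F / m % 2 = 0).card := by
  have h1 : ((Finset.Icc 1 (F + 1)).filter fun m => F / m % 2 = 0).card =
      ((Finset.Icc 1 F).filter fun m => F / m % 2 = 0).card + 1 := by
    rw [← Finset.insert_Icc_right_eq_Icc_add_one (by omega), Finset.filter_insert,
      if_pos (by rw [Nat.div_eq_of_lt (Nat.lt_add_one F)]),
      Finset.card_insert_of_notMem (by simp)]
  have h2 := Finset.card_filter_add_card_filter_not
    (s := (Finset.Icc 1 (F + 1)).filter fun m => F / m % 2 = 0) (fun m => 2 * m ∣ F)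
  rw [Finset.filter_filter, Finset.filter_filter] at h2
  have h3 : ((Finset.Icc 1 (F + 1)).filter fun m => F / m % 2 = 0 ∧ 2 * m ∣ F) =
      (Finset.Icc 1 (F + 1)).filter fun m => 2 * m ∣ F := by
    apply Finset.filter_congr
    intro m hm
    simp only [Finset.mem_Icc] at hm
    refine ⟨And.right, fun h => ⟨?_, h⟩⟩
    obtain ⟨k, rfl⟩ := h
    rw [show 2 * m * k = m * (2 * k) by ring, Nat.mul_div_cancel_left _ (by omega)]
    omega
  rw [h3, ← card_even_divisors hF, h1] at h2
  rw [reflectiveMults]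
  omega

theorem stmt18 (F : ℕ) (hF : 0 < F) :
    ({S : Set ℕ | IsNumericalSemigroup S ∧ Reflective S ∧ frob S = F}.ncard : ℤ) =
      1 - ((Nat.divisors F).filter (fun d => 2 ∣ d)).card +
        ∑ k ∈ Finset.Icc 2 F, (-1 : ℤ) ^ k * ((F / k : ℕ) : ℤ) := by
  rw [setOf_reflective_eq_image hF, (injOn_reflectiveModel F).ncard_image,
    Set.ncard_coe_finset, card_reflectiveMults hF, sum_Icc_neg_one_pow_mul_div hF]
end

section
/- For every integer g ≥ 1, the number of reflective numerical semigroups of genus g equals g + 1 − τ(g), where τ(g) is the number of positive divisors of g. Moreover, the number of reflective numerical semigroups of genus g that are also symmetric equals 1 if g = 1, and equals τ(g−1) − 1 if g > 1. -/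
/-- The set whose elements below `g` are the multiples of `m`, whose complement in `[g, 2 * g)` is
the translate by `g` of these multiples, and which contains every integer from `2 * g` on. -/
def reflectiveOfStep (g m : ℕ) : Set ℕ :=
  {x | (x < g ∧ m ∣ x) ∨ (g ≤ x ∧ x < 2 * g ∧ ¬ m ∣ x - g) ∨ 2 * g ≤ x}

lemma mem_reflectiveOfStep_of_lt {g m x : ℕ} (hx : x < g) :
    x ∈ reflectiveOfStep g m ↔ m ∣ x := by
  simp only [reflectiveOfStep, Set.mem_ofPred_eq]
  constructor
  · rintro (h | h | h)
    · exact h.2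
    · omega
    · omega
  · exact fun h => Or.inl ⟨hx, h⟩

lemma add_mem_reflectiveOfStep_of_lt {g m x : ℕ} (hx : x < g) :
    x + g ∈ reflectiveOfStep g m ↔ ¬ m ∣ x := by
  simp only [reflectiveOfStep, Set.mem_ofPred_eq, Nat.add_sub_cancel]
  constructor
  · rintro (h | h | h)
    · omega
    · exact h.2.2
    · omega
  · exact fun h => Or.inr (Or.inl ⟨by omega, by omega, h⟩)

lemma mem_reflectiveOfStep_of_le {g m x : ℕ} (hx : 2 * g ≤ x) : x ∈ reflectiveOfStep g m :=
  Or.inr (Or.inr hx)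

lemma isNumericalSemigroup_reflectiveOfStep {g m : ℕ} (hg : 1 ≤ g) (hm : ¬ m ∣ g) :
    IsNumericalSemigroup (reflectiveOfStep g m) := by
  refine ⟨(mem_reflectiveOfStep_of_lt hg).2 (dvd_zero m), ?_, ?_⟩
  · have key : ∀ a b, a < g → m ∣ a → b ∈ reflectiveOfStep g m →
        a + b ∈ reflectiveOfStep g m := by
      intro a b ha hma hb
      rcases lt_or_ge b g with hbg | hbg
      · have hmb := (mem_reflectiveOfStep_of_lt hbg).1 hb
        have hab := dvd_add hma hmb
        rcases lt_or_ge (a + b) g with h | h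
        · exact (mem_reflectiveOfStep_of_lt h).2 hab
        · obtain ⟨c, hc⟩ := Nat.exists_eq_add_of_le' h
          rw [hc] at hab ⊢
          exact (add_mem_reflectiveOfStep_of_lt (by omega)).2
            fun hmc => hm ((Nat.dvd_add_right hmc).1 hab)
      · rcases lt_or_ge (a + b) (2 * g) with h | h
        · obtain ⟨c, rfl⟩ := Nat.exists_eq_add_of_le' hbg
          have hmc := (add_mem_reflectiveOfStep_of_lt (by omega)).1 hb
          rw [← add_assoc]
          exact (add_mem_reflectiveOfStep_of_lt (by omega)).2
            fun h => hmc ((Nat.dvd_add_right hma).1 h)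
        · exact mem_reflectiveOfStep_of_le h
    intro a ha b hb
    rcases lt_or_ge a g with hag | hag
    · exact key a b hag ((mem_reflectiveOfStep_of_lt hag).1 ha) hb
    · rcases lt_or_ge b g with hbg | hbg
      · rw [add_comm]
        exact key b a hbg ((mem_reflectiveOfStep_of_lt hbg).1 hb) ha
      · exact mem_reflectiveOfStep_of_le (by omega)
  · refine (Set.finite_lt_nat (2 * g)).subset fun x hx => ?_
    by_contra h
    exact hx (mem_reflectiveOfStep_of_le (not_lt.1 h))

open Classical in
/-- If exactly one of `z` and `z + g` lies in `S` for each `z < g`, the image of this map consists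
of the `g` gaps of `S` below `2 * g`. -/
noncomputable def gapMap (S : Set ℕ) (g x : ℕ) : ℕ := if x ∈ S then x + g else x

lemma injOn_gapMap (S : Set ℕ) (g : ℕ) : Set.InjOn (gapMap S g) (Set.Iio g) := by
  intro x hx y hy h
  simp only [Set.mem_Iio] at hx hy
  unfold gapMap at h
  split_ifs at h <;> omega

lemma ncard_image_gapMap (S : Set ℕ) (g : ℕ) : (gapMap S g '' Set.Iio g).ncard = g := by
  rw [(injOn_gapMap S g).ncard_image]
  simp [← Finset.coe_Iio]

lemma image_gapMap_subset {S : Set ℕ} {g : ℕ} (h : ∀ z < g, Xor (z ∈ S) (z + g ∈ S)) :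
    gapMap S g '' Set.Iio g ⊆ Sᶜ := by
  rintro _ ⟨x, hx, rfl⟩
  have := h x hx
  unfold gapMap
  split_ifs with hxS
  · rcases this with h | h
    · exact h.2
    · exact absurd hxS h.2
  · exact hxS

lemma xor_mem_reflectiveOfStep {g m z : ℕ} (hz : z < g) :
    Xor (z ∈ reflectiveOfStep g m) (z + g ∈ reflectiveOfStep g m) := by
  rw [mem_reflectiveOfStep_of_lt hz, add_mem_reflectiveOfStep_of_lt hz]
  unfold Xor
  tauto

lemma genus_reflectiveOfStep (g m : ℕ) : genus (reflectiveOfStep g m) = g := by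
  have h : (reflectiveOfStep g m)ᶜ = gapMap (reflectiveOfStep g m) g '' Set.Iio g := by
    refine Set.Subset.antisymm (fun x hx => ?_)
      (image_gapMap_subset fun z => xor_mem_reflectiveOfStep)
    rcases lt_or_ge x g with h | h
    · exact ⟨x, h, if_neg hx⟩
    · obtain ⟨c, rfl⟩ := Nat.exists_eq_add_of_le' h
      have hc : c < g := by
        by_contra hc
        exact hx (mem_reflectiveOfStep_of_le (by omega))
      refine ⟨c, hc, if_pos ?_⟩
      rcases xor_mem_reflectiveOfStep (m := m) hc with h | h
      · exact h.1
      · exact absurd h.1 hx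
  rw [genus, h, ncard_image_gapMap]

lemma reflective_reflectiveOfStep (g m : ℕ) : Reflective (reflectiveOfStep g m) := by
  intro z hz
  rw [genus_reflectiveOfStep] at hz ⊢
  exact xor_mem_reflectiveOfStep hz

lemma IsNumericalSemigroup.mem_of_two_mul_genus_le {S : Set ℕ} (hS : IsNumericalSemigroup S)
    (hR : Reflective S) {x : ℕ} (hx : 2 * genus S ≤ x) : x ∈ S := by
  have h : gapMap S (genus S) '' Set.Iio (genus S) = Sᶜ :=
    Set.eq_of_subset_of_ncard_le (image_gapMap_subset hR) (ncard_image_gapMap _ _).ge hS.2.2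
  by_contra hxS
  obtain ⟨y, hy, hyx⟩ := h.ge hxS
  simp only [Set.mem_Iio] at hy
  unfold gapMap at hyx
  split_ifs at hyx <;> omega

lemma IsNumericalSemigroup.mul_mem {S : Set ℕ} (hS : IsNumericalSemigroup S) {m : ℕ}
    (hm : m ∈ S) (k : ℕ) : m * k ∈ S := by
  induction k with
  | zero => exact hS.1
  | succ k ih => exact hS.2.1 _ ih _ hm

lemma IsNumericalSemigroup.sub_mem {S : Set ℕ} (hS : IsNumericalSemigroup S)
    (hR : Reflective S) {a b : ℕ} (ha : a ∈ S) (hab : a + b ∈ S) (h : a + b < genus S) :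
    b ∈ S := by
  by_contra hb
  rcases hR b (by omega) with h' | h'
  · exact hb h'.1
  · have hmem := hS.2.1 _ ha _ h'.1
    rw [← add_assoc] at hmem
    rcases hR (a + b) h with h'' | h''
    · exact h''.2 hmem
    · exact h''.2 hab

lemma IsNumericalSemigroup.exists_step {S : Set ℕ} (hS : IsNumericalSemigroup S)
    (hR : Reflective S) : ∃ m ∈ S, ∀ x < genus S, x ∈ S → m ∣ x := by
  classical
  by_cases hex : ∃ n, n ∈ S ∧ 0 < n
  · refine ⟨Nat.find hex, (Nat.find_spec hex).1, fun x => ?_⟩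
    induction x using Nat.strong_induction_on with
    | _ x ih =>
      intro hx hxS
      rcases Nat.eq_zero_or_pos x with rfl | hpos
      · exact dvd_zero _
      · obtain ⟨c, hc⟩ := Nat.exists_eq_add_of_le (Nat.find_min' hex ⟨hxS, hpos⟩)
        have hm := Nat.find_spec hex
        generalize Nat.find hex = m at *
        subst hc
        exact (Nat.dvd_add_right dvd_rfl).2
          (ih c (by omega) (by omega) (hS.sub_mem hR hm.1 hxS hx))
  · push Not at hex
    exact ⟨0, hS.1, fun x _ hxS => by simp [Nat.le_zero.1 (hex x hxS)]⟩

lemma IsNumericalSemigroup.eq_reflectiveOfStep {S : Set ℕ} (hS : IsNumericalSemigroup S)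
    (hR : Reflective S) (hg : 1 ≤ genus S) :
    ∃ m ≤ genus S, ¬ m ∣ genus S ∧ reflectiveOfStep (genus S) m = S := by
  have hgS : genus S ∉ S := by
    have := hR 0 hg
    rw [zero_add] at this
    rcases this with h | h
    · exact h.2
    · exact absurd hS.1 h.2
  obtain ⟨m, hm, hle, hdvd⟩ :
      ∃ m ∈ S, m ≤ genus S ∧ ∀ x < genus S, x ∈ S → m ∣ x := by
    obtain ⟨m, hm, hdvd⟩ := hS.exists_step hR
    rcases le_or_gt m (genus S) with h | h
    · exact ⟨m, hm, h, hdvd⟩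
    · refine ⟨0, hS.1, Nat.zero_le _, fun x hx hxS => ?_⟩
      simp [Nat.eq_zero_of_dvd_of_lt (hdvd x hx hxS) (hx.trans h)]
  have hiff : ∀ x < genus S, (x ∈ S ↔ m ∣ x) := fun x hx =>
    ⟨hdvd x hx, fun ⟨k, hk⟩ => hk ▸ hS.mul_mem hm k⟩
  refine ⟨m, hle, fun ⟨k, hk⟩ => hgS (hk ▸ hS.mul_mem hm k), ?_⟩
  ext x
  rcases lt_or_ge x (genus S) with h | h
  · rw [mem_reflectiveOfStep_of_lt h, hiff x h]
  · obtain ⟨c, rfl⟩ := Nat.exists_eq_add_of_le' h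
    rcases lt_or_ge c (genus S) with hc | hc
    · have : Xor (c ∈ S) (c + genus S ∈ S) := hR c hc
      rw [add_mem_reflectiveOfStep_of_lt hc, ← hiff c hc]
      unfold Xor at this
      tauto
    · exact iff_of_true (mem_reflectiveOfStep_of_le (by omega))
        (hS.mem_of_two_mul_genus_le hR (by omega))

lemma setOf_reflective_eq_image_s19 {g : ℕ} (hg : 1 ≤ g) :
    {S : Set ℕ | IsNumericalSemigroup S ∧ Reflective S ∧ genus S = g} =
      reflectiveOfStep g '' ((Finset.range (g + 1)).filter fun m => ¬ m ∣ g) := by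
  ext S
  simp only [Set.mem_ofPred_eq, Set.mem_image, Finset.coe_filter, Finset.mem_range,
    Nat.lt_succ_iff]
  constructor
  · rintro ⟨hS, hR, rfl⟩
    obtain ⟨m, hle, hm, h⟩ := hS.eq_reflectiveOfStep hR hg
    exact ⟨m, ⟨hle, hm⟩, h⟩
  · rintro ⟨m, ⟨-, hm⟩, rfl⟩
    exact ⟨isNumericalSemigroup_reflectiveOfStep hg hm, reflective_reflectiveOfStep g m,
      genus_reflectiveOfStep g m⟩

lemma injOn_reflectiveOfStep (g : ℕ) :
    Set.InjOn (reflectiveOfStep g) ((Finset.range (g + 1)).filter fun m => ¬ m ∣ g) := by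
  intro m hm n hn h
  simp only [Finset.coe_filter, Finset.mem_range, Nat.lt_succ_iff, Set.mem_ofPred_eq] at hm hn
  have hmg : m < g := lt_of_le_of_ne hm.1 fun h => hm.2 h.dvd
  have hng : n < g := lt_of_le_of_ne hn.1 fun h => hn.2 h.dvd
  apply Nat.dvd_antisymm
  · rw [← mem_reflectiveOfStep_of_lt hng, h, mem_reflectiveOfStep_of_lt hng]
  · rw [← mem_reflectiveOfStep_of_lt hmg, ← h, mem_reflectiveOfStep_of_lt hmg]

lemma frob_reflectiveOfStep {g m : ℕ} (hg : 1 ≤ g) :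
    frob (reflectiveOfStep g m) = 2 * g - 1 - (g - 1) % m := by
  have hmod := Nat.mod_le (g - 1) m
  have hgr : IsGreatest (reflectiveOfStep g m)ᶜ (2 * g - 1 - (g - 1) % m) := by
    constructor
    · rw [show 2 * g - 1 - (g - 1) % m = (g - 1 - (g - 1) % m) + g by omega, Set.mem_compl_iff,
        add_mem_reflectiveOfStep_of_lt (by omega), not_not]
      exact Nat.dvd_sub_mod _
    · intro x hx
      by_contra! hlt
      rcases lt_or_ge x (2 * g) with h | h
      · refine hx ?_
        obtain ⟨c, rfl⟩ := Nat.exists_eq_add_of_le' (show g ≤ x by omega)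
        rw [add_mem_reflectiveOfStep_of_lt (by omega)]
        intro hmc
        have hle : (g - 1) % m = (g - 1 - c) % m := by
          conv_lhs => rw [show g - 1 = (g - 1 - c) + c by omega]
          rw [Nat.add_mod, Nat.mod_eq_zero_of_dvd hmc, add_zero, Nat.mod_mod]
        have := Nat.mod_le (g - 1 - c) m
        omega
      · exact hx (mem_reflectiveOfStep_of_le h)
  exact hgr.csSup_eq

lemma isSymmetricNS_reflectiveOfStep_iff {g m : ℕ} (hg : 1 ≤ g) (hm : ¬ m ∣ g) :
    IsSymmetricNS (reflectiveOfStep g m) ↔ m ∣ g - 1 := by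
  constructor
  · intro h
    by_contra hdvd
    have hmod := Nat.mod_le (g - 1) m
    have hr : (g - 1) % m ≠ 0 := fun h => hdvd (Nat.dvd_of_mod_eq_zero h)
    rcases h ((g - 1 : ℕ) : ℤ) with ⟨⟨-, h⟩, -⟩ | ⟨⟨-, h⟩, -⟩
    · rw [Int.toNat_natCast, mem_reflectiveOfStep_of_lt (by omega)] at h
      exact hdvd h
    · rw [frob_reflectiveOfStep hg,
        show (((2 * g - 1 - (g - 1) % m : ℕ) : ℤ) - ((g - 1 : ℕ) : ℤ)).toNat =
          (g - 1 - (g - 1) % m) + 1 by omega,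
        mem_reflectiveOfStep_of_lt (by omega)] at h
      have : m ∣ 1 := (Nat.dvd_add_right (Nat.dvd_sub_mod _)).1 h
      exact hm (this.trans (one_dvd g))
  · intro hdvd
    have hF : frob (reflectiveOfStep g m) = 2 * g - 1 := by
      rw [frob_reflectiveOfStep hg, Nat.mod_eq_zero_of_dvd hdvd, Nat.sub_zero]
    have hnat : ∀ x < g, (2 * g - 1 - x ∈ reflectiveOfStep g m ↔
        x ∉ reflectiveOfStep g m) := by
      intro x hx
      rw [show 2 * g - 1 - x = (g - 1 - x) + g by omega,
        add_mem_reflectiveOfStep_of_lt (by omega), mem_reflectiveOfStep_of_lt hx,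
        Nat.dvd_sub_iff_right (by omega) hdvd]
    intro z
    rw [hF]
    change Xor _ _
    unfold memZ Xor
    rcases lt_or_ge z 0 with hz | hz
    · exact Or.inr ⟨⟨by omega, mem_reflectiveOfStep_of_le (by omega)⟩, by omega⟩
    · lift z to ℕ using hz
      rcases lt_or_ge z (2 * g) with hzg | hzg
      · rw [show (((2 * g - 1 : ℕ) : ℤ) - (z : ℤ)).toNat = 2 * g - 1 - z by omega,
          Int.toNat_natCast]
        have h1 : (0 : ℤ) ≤ z := by omega
        have h2 : (0 : ℤ) ≤ ((2 * g - 1 : ℕ) : ℤ) - (z : ℤ) := by omega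
        rcases lt_or_ge z g with h | h
        · have := hnat z h
          tauto
        · have := hnat (2 * g - 1 - z) (by omega)
          rw [show 2 * g - 1 - (2 * g - 1 - z) = z by omega] at this
          simp only [h1, h2, true_and, this, not_not, and_self]
          exact (em _).symm
      · exact Or.inl ⟨⟨by omega, mem_reflectiveOfStep_of_le (by omega)⟩, by omega⟩

lemma setOf_reflective_symmetric_eq_image {g : ℕ} (hg : 1 ≤ g) :
    {S : Set ℕ | IsNumericalSemigroup S ∧ Reflective S ∧ genus S = g ∧ IsSymmetricNS S} =
      reflectiveOfStep g ''
        ((Finset.range (g + 1)).filter fun m => ¬ m ∣ g ∧ m ∣ g - 1) := by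
  have h := setOf_reflective_eq_image_s19 hg
  ext S
  have hS := Set.ext_iff.1 h S
  simp only [Set.mem_ofPred_eq, Set.mem_image, Finset.coe_filter, Finset.mem_range] at hS ⊢
  rw [← and_assoc (a := Reflective S), ← and_assoc, hS]
  constructor
  · rintro ⟨⟨m, hm, rfl⟩, hsymm⟩
    exact ⟨m, ⟨hm.1, hm.2, (isSymmetricNS_reflectiveOfStep_iff hg hm.2).1 hsymm⟩, rfl⟩
  · rintro ⟨m, ⟨hlt, hm, hdvd⟩, rfl⟩
    exact ⟨⟨m, ⟨hlt, hm⟩, rfl⟩, (isSymmetricNS_reflectiveOfStep_iff hg hm).2 hdvd⟩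

lemma card_filter_not_dvd {g : ℕ} (hg : 1 ≤ g) :
    ((Finset.range (g + 1)).filter fun m => ¬ m ∣ g).card + (Nat.divisors g).card = g + 1 := by
  have h : Nat.divisors g = (Finset.range (g + 1)).filter fun m => m ∣ g := by
    ext m
    simp only [Nat.mem_divisors, Finset.mem_filter, Finset.mem_range, Nat.lt_succ_iff]
    exact ⟨fun h => ⟨Nat.le_of_dvd hg h.1, h.1⟩, fun h => ⟨h.2, by omega⟩⟩
  rw [h, add_comm, Finset.card_filter_add_card_filter_not, Finset.card_range]

lemma filter_not_dvd_and_dvd_pred {g : ℕ} (hg : 1 < g) :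
    ((Finset.range (g + 1)).filter fun m => ¬ m ∣ g ∧ m ∣ g - 1) =
      (Nat.divisors (g - 1)).erase 1 := by
  ext m
  simp only [Finset.mem_filter, Finset.mem_range, Finset.mem_erase, Nat.mem_divisors]
  constructor
  · rintro ⟨-, hm, hdvd⟩
    exact ⟨fun h => hm (h ▸ one_dvd g), hdvd, by omega⟩
  · rintro ⟨h1, hdvd, h0⟩
    have hle := Nat.le_of_dvd (by omega) hdvd
    refine ⟨by omega, fun hm => h1 ?_, hdvd⟩
    rw [← Nat.dvd_one]
    exact (Nat.dvd_add_right hdvd).1 (by rwa [Nat.sub_add_cancel hg.le])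

theorem stmt19 (g : ℕ) (hg : 1 ≤ g) :
    ({S : Set ℕ | IsNumericalSemigroup S ∧ Reflective S ∧ genus S = g}.ncard : ℤ) =
      (g : ℤ) + 1 - (Nat.divisors g).card ∧
    ({S : Set ℕ | IsNumericalSemigroup S ∧ Reflective S ∧ genus S = g ∧
        IsSymmetricNS S}.ncard : ℤ) =
      if g = 1 then 1 else ((Nat.divisors (g - 1)).card : ℤ) - 1 := by
  constructor
  · rw [setOf_reflective_eq_image_s19 hg, (injOn_reflectiveOfStep g).ncard_image,
      Set.ncard_coe_finset]
    have := card_filter_not_dvd hg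
    omega
  · rw [setOf_reflective_symmetric_eq_image hg, ((injOn_reflectiveOfStep g).mono
      (Finset.coe_subset.2 (Finset.monotone_filter_right _ fun _ _ h => h.1))).ncard_image,
      Set.ncard_coe_finset]
    split_ifs with h1
    · subst h1
      decide
    · rw [filter_not_dvd_and_dvd_pred (by omega)]
      have hmem : 1 ∈ Nat.divisors (g - 1) := Nat.one_mem_divisors.2 (by omega)
      rw [Finset.card_erase_of_mem hmem, Nat.cast_sub (Finset.card_pos.2 ⟨1, hmem⟩), Nat.cast_one]
end
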